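/- Equip O(Σ_q³(l,+)) with the ℤ-grading determined by deg x' = 1, deg y' = 1, deg z' = −1. Then z'* is a central unitary element of degree 1, and the assignment u ↦ z'* extends to a unital *-algebra homomorphism j from the Laurent polynomial Hopf algebra ℂ[u,u*] to O(Σ_q³(l,+)) such that j(uⁿ) = z'*ⁿ has degree n for every n ∈ ℤ. Consequently the ℂ[u,u*]-comodule algebra O(Σ_q³(l,+)) is trivial (cleft with an algebra-map cleaving map). -/

import Mathlib

/-- The defining relations of `O(Σ_q³(l,+))`: `x'y' = q^{2l}y'x'`, `x'y'* = q^{2l}y'*x'`,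
`y'y'* = q⁴y'*y'`, `y'* = y'z'²`, `x'x'* = ∏_{p=0}^{l−1}(1 − q^{2p}y'z')`,
`x'*x' = ∏_{p=1}^{l}(1 − q^{−2p}y'z')`, with `z'` central (it suffices to commute with
the generators and their adjoints) and unitary. -/
structure SPlusRels {A : Type} [Ring A] [Algebra ℂ A] [StarRing A] [StarModule ℂ A]
    (q : ℝ) (l : ℕ) (x y z : A) : Prop where
  central_x : z * x = x * z
  central_y : z * y = y * z
  central_xs : z * star x = star x * z
  central_ys : z * star y = star y * z
  unitary : z * star z = 1
  unitary' : star z * z = 1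
  rel_xy : x * y = ((q : ℂ) ^ (2 * l)) • (y * x)
  rel_xys : x * star y = ((q : ℂ) ^ (2 * l)) • (star y * x)
  rel_yys : y * star y = ((q : ℂ) ^ 4) • (star y * y)
  rel_ystar : star y = y * z ^ 2
  rel_xxs : x * star x =
    ((List.range l).map (fun p => 1 - ((q : ℂ) ^ (2 * p)) • (y * z))).prod
  rel_xsx : star x * x =
    ((List.range l).map (fun p => 1 - (((q : ℂ)⁻¹) ^ (2 * (p + 1))) • (y * z))).prod

/-- A presentation of `O(Σ_q³(l,+))`: the *universal* unital complex *-algebra with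
generators `x', y'` and a central unitary `z'` subject to `SPlusRels`. -/
structure SPlusAlg (q : ℝ) (l : ℕ) where
  A : Type
  [ringA : Ring A]
  [algA : Algebra ℂ A]
  [starA : StarRing A]
  [smodA : StarModule ℂ A]
  x : A
  y : A
  z : A
  rels : SPlusRels q l x y z
  universal : ∀ (B : Type) [Ring B] [Algebra ℂ B] [StarRing B] [StarModule ℂ B]
      (x' y' z' : B), SPlusRels q l x' y' z' →
      ∃! f : A →⋆ₐ[ℂ] B, f x = x' ∧ f y = y' ∧ f z = z'

attribute [instance] SPlusAlg.ringA SPlusAlg.algA SPlusAlg.starA SPlusAlg.smodA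

/-- Integer powers of a unitary element: `w^t` for `t ≥ 0` and `(w*)^{−t}` for `t < 0`. -/
def zpowStar {A : Type*} [Monoid A] [Star A] (w : A) : ℤ → A
  | Int.ofNat n => w ^ n
  | Int.negSucc n => (star w) ^ (n + 1)

theorem zpowStar_eq_unit_zpow {A : Type*} [Monoid A] [StarMul A] (w : Aˣ)
    (hw : star (w : A) = ((w⁻¹ : Aˣ) : A)) (n : ℤ) :
    zpowStar (w : A) n = ((w ^ n : Aˣ) : A) := by
  cases n with
  | ofNat n => simp [zpowStar]
  | negSucc n => simp [zpowStar, hw, zpow_negSucc, ← inv_pow]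

theorem SPlusRels.of_injective {A B : Type} [Ring A] [Algebra ℂ A] [StarRing A] [StarModule ℂ A]
    [Ring B] [Algebra ℂ B] [StarRing B] [StarModule ℂ B] {q : ℝ} {l : ℕ}
    (f : B →⋆ₐ[ℂ] A) (hf : Function.Injective f) {x y z : B}
    (h : SPlusRels q l (f x) (f y) (f z)) : SPlusRels q l x y z where
  central_x := hf (by simpa using h.central_x)
  central_y := hf (by simpa using h.central_y)
  central_xs := hf (by simpa [map_star] using h.central_xs)
  central_ys := hf (by simpa [map_star] using h.central_ys)
  unitary := hf (by simpa [map_star] using h.unitary)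
  unitary' := hf (by simpa [map_star] using h.unitary')
  rel_xy := hf (by simpa only [map_mul, map_smul] using h.rel_xy)
  rel_xys := hf (by simpa only [map_mul, map_smul, map_star] using h.rel_xys)
  rel_yys := hf (by simpa only [map_mul, map_smul, map_star] using h.rel_yys)
  rel_ystar := hf (by simpa only [map_mul, map_pow, map_star] using h.rel_ystar)
  rel_xxs := hf (by
    simpa only [map_mul, map_star, map_list_prod, List.map_map, Function.comp_def, map_sub,
      map_one, map_smul] using h.rel_xxs)
  rel_xsx := hf (by
    simpa only [map_mul, map_star, map_list_prod, List.map_map, Function.comp_def, map_sub,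
      map_one, map_smul] using h.rel_xsx)

/-- The generators of `O(Σ_q³(l,+))` generate it as a unital *-algebra. -/
theorem SPlusAlg.mem_of_generators_mem {q : ℝ} {l : ℕ} (P : SPlusAlg q l)
    (S : StarSubalgebra ℂ P.A) (hx : P.x ∈ S) (hy : P.y ∈ S) (hz : P.z ∈ S) (a : P.A) :
    a ∈ S := by
  have hS : SPlusRels q l (⟨P.x, hx⟩ : S) ⟨P.y, hy⟩ ⟨P.z, hz⟩ :=
    SPlusRels.of_injective S.subtype Subtype.val_injective P.rels
  obtain ⟨f, ⟨hfx, hfy, hfz⟩, -⟩ := P.universal S _ _ _ hS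
  have key : S.subtype.comp f = StarAlgHom.id ℂ P.A :=
    (P.universal P.A P.x P.y P.z P.rels).unique
      ⟨by simp [hfx], by simp [hfy], by simp [hfz]⟩ ⟨rfl, rfl, rfl⟩
  have h : ((f a : S) : P.A) = a := DFunLike.congr_fun key a
  exact h ▸ (f a).2

theorem SPlusAlg.star_z_central {q : ℝ} {l : ℕ} (P : SPlusAlg q l) (a : P.A) :
    star P.z * a = a * star P.z := by
  have comm {b c : P.A} (h : c * star b = star b * c) : b * star c = star c * b := by
    simpa using congrArg star h
  have mem {b : P.A} (h : P.z * b = b * P.z) (hs : P.z * star b = star b * P.z) :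
      b ∈ StarSubalgebra.centralizer ℂ {P.z} := by
    rw [StarSubalgebra.mem_centralizer_iff]
    rintro _ rfl
    exact ⟨h, (comm hs).symm⟩
  have ha := P.mem_of_generators_mem (StarSubalgebra.centralizer ℂ {P.z})
    (mem P.rels.central_x P.rels.central_xs) (mem P.rels.central_y P.rels.central_ys)
    (mem rfl (P.rels.unitary.trans P.rels.unitary'.symm)) a
  exact ((StarSubalgebra.mem_centralizer_iff ℂ).1 ha P.z rfl).2

theorem unit_zpow_mem_of_graded {A : Type*} [Ring A] [Algebra ℂ A] {𝒜 : ℤ → Submodule ℂ A}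
    (hone : (1 : A) ∈ 𝒜 0)
    (hmul : ∀ (m n : ℤ), ∀ a ∈ 𝒜 m, ∀ b ∈ 𝒜 n, a * b ∈ 𝒜 (m + n))
    (w : Aˣ) (hw : (w : A) ∈ 𝒜 1) (hw' : ((w⁻¹ : Aˣ) : A) ∈ 𝒜 (-1)) (n : ℤ) :
    ((w ^ n : Aˣ) : A) ∈ 𝒜 n := by
  induction n with
  | zero => simpa using hone
  | succ n ih => rw [zpow_add_one]; exact hmul _ _ _ ih _ hw
  | pred n ih => rw [zpow_sub_one]; exact hmul _ _ _ ih _ hw'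

/-- equip `O(Σ_q³(l,+))` with the ℤ-grading `𝒜` determined by
`deg x' = 1`, `deg y' = 1`, `deg z' = −1`.  Then `z'*` is a central unitary element of
degree `1`, and `u ↦ z'*` extends to a unital *-algebra homomorphism `j` from the
Laurent polynomial Hopf *-algebra `ℂ[u,u*]` (with `star uⁿ = u^{−n}` on the basis,
conjugate-linearly) to `O(Σ_q³(l,+))` with `j(uⁿ) = z'*ⁿ` of degree `n` for all `n ∈ ℤ`.
Consequently the `ℂ[u,u*]`-comodule algebra `O(Σ_q³(l,+))` is trivial (cleft, with an
algebra-map cleaving map). -/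
theorem splus_comodule_algebra_trivial (q : ℝ) (hq0 : 0 < q) (hq1 : q < 1)
    (l : ℕ) (hl : 0 < l) (hlodd : Odd l) (Pp : SPlusAlg q l)
    (𝒜 : ℤ → Submodule ℂ Pp.A)
    (hone : (1 : Pp.A) ∈ 𝒜 0)
    (hmul : ∀ (m n : ℤ), ∀ a ∈ 𝒜 m, ∀ b ∈ 𝒜 n, a * b ∈ 𝒜 (m + n))
    (hstar : ∀ (n : ℤ), ∀ a ∈ 𝒜 n, star a ∈ 𝒜 (-n))
    (hdec : DirectSum.IsInternal 𝒜)
    (hx : Pp.x ∈ 𝒜 1) (hy : Pp.y ∈ 𝒜 1) (hz : Pp.z ∈ 𝒜 (-1)) :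
    ((∀ a : Pp.A, star Pp.z * a = a * star Pp.z) ∧
      star Pp.z * Pp.z = 1 ∧ Pp.z * star Pp.z = 1 ∧ star Pp.z ∈ 𝒜 1) ∧
    ∃ j : LaurentPolynomial ℂ →ₐ[ℂ] Pp.A,
      (∀ n : ℤ,
        j (LaurentPolynomial.T n) = zpowStar (star Pp.z) n ∧
        j (LaurentPolynomial.T n) ∈ 𝒜 n) ∧
      (∀ n : ℤ, j (LaurentPolynomial.T (-n)) = star (j (LaurentPolynomial.T n))) := by
  have hzs : star Pp.z ∈ 𝒜 1 := by simpa using hstar _ _ hz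
  refine ⟨⟨Pp.star_z_central, Pp.rels.unitary', Pp.rels.unitary, hzs⟩, ?_⟩
  let w : Pp.Aˣ := ⟨star Pp.z, Pp.z, Pp.rels.unitary', Pp.rels.unitary⟩
  have hw : star (w : Pp.A) = ((w⁻¹ : Pp.Aˣ) : Pp.A) := star_star Pp.z
  let j : LaurentPolynomial ℂ →ₐ[ℂ] Pp.A :=
    AddMonoidAlgebra.lift ℂ Pp.A ℤ ((Units.coeHom Pp.A).comp (zpowersHom Pp.Aˣ w))
  have hj (n : ℤ) : j (LaurentPolynomial.T n) = ((w ^ n : Pp.Aˣ) : Pp.A) := by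
    simp [j, LaurentPolynomial.T, - LaurentPolynomial.single_eq_C_mul_T]
  refine ⟨j, fun n => ⟨?_, ?_⟩, fun n => ?_⟩
  · rw [hj]
    exact (zpowStar_eq_unit_zpow w hw n).symm
  · rw [hj]
    exact unit_zpow_mem_of_graded hone hmul w hzs hz n
  · have hsw : star w = w⁻¹ := Units.ext hw
    rw [hj, hj, ← Units.coe_star, star_zpow, hsw, inv_zpow, zpow_neg]
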